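/- arXiv:1107.4255 — 7 statements merged into one kernel-verified Lean document; each statement's English description precedes it below -/
import Mathlib

section
/- Let n be a natural number and let A, B be n×n complex matrices. If i(A − Aᴴ) is positive semidefinite and i(B − Bᴴ) is positive definite, then det(I − A·B) ≠ 0. -/
open Matrix
open scoped ComplexOrder

theorem star_dotProduct_I_smul_sub_conjTranspose_mulVec {ι : Type*} [Fintype ι]
    (M : Matrix ι ι ℂ) (x : ι → ℂ) :
    star x ⬝ᵥ ((Complex.I • (M - Mᴴ)) *ᵥ x) = ((-2 * (star x ⬝ᵥ (M *ᵥ x)).im : ℝ) : ℂ) := by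
  have h : star x ⬝ᵥ (Mᴴ *ᵥ x) = star (star x ⬝ᵥ (M *ᵥ x)) := by
    rw [dotProduct_mulVec, ← star_mulVec, star_dotProduct]
  rw [smul_mulVec, dotProduct_smul, sub_mulVec, dotProduct_sub, h]
  apply Complex.ext <;> simp
  ring

theorem det_one_sub_mul_ne_zero {n : ℕ} (A B : Matrix (Fin n) (Fin n) ℂ)
    (hA : (Complex.I • (A - Aᴴ)).PosSemidef)
    (hB : (Complex.I • (B - Bᴴ)).PosDef) :
    (1 - A * B).det ≠ 0 := by
  intro hdet
  obtain ⟨v, hv, hker⟩ := exists_mulVec_eq_zero_iff.mpr hdet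
  rw [sub_mulVec, one_mulVec, ← mulVec_mulVec, sub_eq_zero] at hker
  have ha := hA.dotProduct_mulVec_nonneg (B *ᵥ v)
  have hb := hB.dotProduct_mulVec_pos hv
  rw [star_dotProduct_I_smul_sub_conjTranspose_mulVec] at ha hb
  rw [← hker, Complex.zero_le_real] at ha
  rw [Complex.zero_lt_real] at hb
  have him : (star (B *ᵥ v) ⬝ᵥ v).im = -(star v ⬝ᵥ (B *ᵥ v)).im := by
    rw [star_dotProduct, ← Complex.conj_im]
    rfl
  linarith
end

section
/- Let A ∈ ℝ^{n×n}, B ∈ ℝ^{n×m}, C ∈ ℝ^{m×n}, and suppose there exist P = Pᵀ ∈ ℝ^{n×n}, L ∈ ℝ^{m×n}, W ∈ ℝ^{m×m} such that P A + Aᵀ P = −Lᵀ L, P B − Aᵀ Cᵀ = −Lᵀ W, and C B + Bᵀ Cᵀ = Wᵀ W. Then for every real ω such that the complex matrix iωI − A is invertible, setting X = (iωI − A)⁻¹ B and G̃(iω) = C X (all real matrices identified with their complex images entrywise), one has the identity iω·(G̃(iω) − G̃(iω)ᴴ) = (L X + W)ᴴ (L X + W). In particular, for every ω > 0 such that iωI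 − A is invertible, the matrix i(G̃(iω) − G̃(iω)ᴴ) is positive semidefinite. -/
open Matrix
open scoped ComplexOrder

/-- The dissipation identity behind the negative imaginary lemma, over a commutative star ring: a
certificate `(P, L, W)` and a solution `X` of `s X = A X + B` with `s` skew-adjoint give
`s (C X - (C X)ᴴ) = (L X + W)ᴴ (L X + W)`. -/
theorem smul_sub_conjTranspose_eq_of_ni_certificate {R n m k : Type*} [CommRing R] [StarRing R]
    [Fintype n] [Fintype m] [Fintype k]
    {A P : Matrix n n R} {B X : Matrix n m R} {C : Matrix m n R} {L : Matrix k n R}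
    {W : Matrix k m R} {s : R} (hs : star s = -s) (hP : Pᴴ = P)
    (h1 : P * A + Aᴴ * P = -(Lᴴ * L)) (h2 : P * B - Aᴴ * Cᴴ = -(Lᴴ * W))
    (h3 : C * B + Bᴴ * Cᴴ = Wᴴ * W) (hX : s • X = A * X + B) :
    s • (C * X - (C * X)ᴴ) = (L * X + W)ᴴ * (L * X + W) := by
  have h2' : Bᴴ * P - C * A = -(Wᴴ * L) := by
    simpa [hP] using congrArg conjTranspose h2
  have hX' : -(s • Xᴴ) = Xᴴ * Aᴴ + Bᴴ := by
    simpa [hs] using congrArg conjTranspose hX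
  calc s • (C * X - (C * X)ᴴ)
      = C * (s • X) + -(s • Xᴴ) * Cᴴ - Xᴴ * P * (s • X) - -(s • Xᴴ) * P * X := by
        simp only [conjTranspose_mul, smul_sub, Matrix.mul_smul, Matrix.smul_mul, Matrix.neg_mul]
        abel
    _ = -(Xᴴ * (P * A + Aᴴ * P) * X) - Xᴴ * (P * B - Aᴴ * Cᴴ) - (Bᴴ * P - C * A) * X
          + (C * B + Bᴴ * Cᴴ) := by
        rw [hX, hX']
        simp only [Matrix.mul_add, Matrix.add_mul, Matrix.mul_sub, Matrix.sub_mul,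
          Matrix.mul_assoc]
        abel
    _ = (L * X + W)ᴴ * (L * X + W) := by
        rw [h1, h2, h2', h3]
        simp only [conjTranspose_add, conjTranspose_mul, Matrix.mul_add, Matrix.add_mul,
          Matrix.mul_neg, Matrix.neg_mul, Matrix.mul_assoc]
        abel

theorem conjTranspose_map_ofReal {m n : Type*} (M : Matrix m n ℝ) :
    (M.map Complex.ofReal)ᴴ = Mᵀ.map Complex.ofReal := by
  ext i j
  simp

theorem ni_lemma_frequency_condition {n m : ℕ}
    (A : Matrix (Fin n) (Fin n) ℝ) (B : Matrix (Fin n) (Fin m) ℝ)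
    (C : Matrix (Fin m) (Fin n) ℝ)
    (P : Matrix (Fin n) (Fin n) ℝ) (L : Matrix (Fin m) (Fin n) ℝ)
    (W : Matrix (Fin m) (Fin m) ℝ)
    (hP : Pᵀ = P)
    (h1 : P * A + Aᵀ * P = -(Lᵀ * L))
    (h2 : P * B - Aᵀ * Cᵀ = -(Lᵀ * W))
    (h3 : C * B + Bᵀ * Cᵀ = Wᵀ * W) :
    (∀ ω : ℝ,
      IsUnit ((Complex.I * (ω : ℂ)) • (1 : Matrix (Fin n) (Fin n) ℂ)
        - A.map Complex.ofReal) →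
      (Complex.I * (ω : ℂ)) •
        (C.map Complex.ofReal *
            (((Complex.I * (ω : ℂ)) • (1 : Matrix (Fin n) (Fin n) ℂ)
              - A.map Complex.ofReal)⁻¹ * B.map Complex.ofReal)
          - (C.map Complex.ofReal *
            (((Complex.I * (ω : ℂ)) • (1 : Matrix (Fin n) (Fin n) ℂ)
              - A.map Complex.ofReal)⁻¹ * B.map Complex.ofReal))ᴴ)
      = (L.map Complex.ofReal *
            (((Complex.I * (ω : ℂ)) • (1 : Matrix (Fin n) (Fin n) ℂ)
              - A.map Complex.ofReal)⁻¹ * B.map Complex.ofReal)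
          + W.map Complex.ofReal)ᴴ *
        (L.map Complex.ofReal *
            (((Complex.I * (ω : ℂ)) • (1 : Matrix (Fin n) (Fin n) ℂ)
              - A.map Complex.ofReal)⁻¹ * B.map Complex.ofReal)
          + W.map Complex.ofReal)) ∧
    (∀ ω : ℝ, 0 < ω →
      IsUnit ((Complex.I * (ω : ℂ)) • (1 : Matrix (Fin n) (Fin n) ℂ)
        - A.map Complex.ofReal) →
      (Complex.I •
        (C.map Complex.ofReal *
            (((Complex.I * (ω : ℂ)) • (1 : Matrix (Fin n) (Fin n) ℂ)
              - A.map Complex.ofReal)⁻¹ * B.map Complex.ofReal)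
          - (C.map Complex.ofReal *
            (((Complex.I * (ω : ℂ)) • (1 : Matrix (Fin n) (Fin n) ℂ)
              - A.map Complex.ofReal)⁻¹ * B.map Complex.ofReal))ᴴ)).PosSemidef) := by
  have key : ∀ ω : ℝ, IsUnit ((Complex.I * (ω : ℂ)) • (1 : Matrix (Fin n) (Fin n) ℂ)
      - A.map Complex.ofReal) → _ := fun ω hω ↦
    smul_sub_conjTranspose_eq_of_ni_certificate
      (A := A.map Complex.ofReal) (P := P.map Complex.ofReal) (B := B.map Complex.ofReal)
      (C := C.map Complex.ofReal) (L := L.map Complex.ofReal) (W := W.map Complex.ofReal)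
      (X := ((Complex.I * (ω : ℂ)) • (1 : Matrix (Fin n) (Fin n) ℂ)
        - A.map Complex.ofReal)⁻¹ * B.map Complex.ofReal)
      (s := Complex.I * ω) (by simp)
      (by rw [conjTranspose_map_ofReal, hP])
      (by
        have h := congrArg (fun M ↦ M.map Complex.ofRealHom) h1
        simp only [Matrix.map_add _ (map_add _), Matrix.map_neg _ (map_neg Complex.ofRealHom), Matrix.map_mul] at h
        simp only [conjTranspose_map_ofReal]
        exact h)
      (by
        have h := congrArg (fun M ↦ M.map Complex.ofRealHom) h2
        simp only [Matrix.map_sub _ (map_sub _), Matrix.map_neg _ (map_neg Complex.ofRealHom), Matrix.map_mul] at h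
        simp only [conjTranspose_map_ofReal]
        exact h)
      (by
        have h := congrArg (fun M ↦ M.map Complex.ofRealHom) h3
        simp only [Matrix.map_add _ (map_add _), Matrix.map_mul] at h
        simp only [conjTranspose_map_ofReal]
        exact h)
      (by
        have h := Matrix.mul_nonsing_inv_cancel_left _ (B.map Complex.ofReal)
          ((Matrix.isUnit_iff_isUnit_det _).1 hω)
        rw [Matrix.sub_mul, Matrix.smul_mul, Matrix.one_mul] at h
        exact sub_eq_iff_eq_add'.1 h)
  refine ⟨key, fun ω hpos hω ↦ ?_⟩
  have hω0 : (ω : ℂ) ≠ 0 := by exact_mod_cast hpos.ne'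
  have hinv : (0 : ℂ) ≤ (ω : ℂ)⁻¹ := by
    rw [← Complex.ofReal_inv]
    exact_mod_cast (inv_pos.2 hpos).le
  have hI : Complex.I = (ω : ℂ)⁻¹ * (Complex.I * ω) := by field_simp
  have h := (posSemidef_conjTranspose_mul_self (L.map Complex.ofReal *
    (((Complex.I * (ω : ℂ)) • (1 : Matrix (Fin n) (Fin n) ℂ)
      - A.map Complex.ofReal)⁻¹ * B.map Complex.ofReal) + W.map Complex.ofReal)).smul hinv
  rwa [← key ω hω, smul_smul, ← hI] at h
end

section
/- Let A ∈ ℝ^{n×n}, B ∈ ℝ^{n×m}, C ∈ ℝ^{m×n}, and suppose P = Pᵀ ∈ ℝ^{n×n} is positive semidefinite and there exist L ∈ ℝ^{m×n}, W ∈ ℝ^{m×m} with P A + Aᵀ P = −Lᵀ L and Bᵀ P − C A = −Wᵀ L. If x ∈ ℝⁿ satisfies P x = 0 and C x = 0, then L x = 0, P (A x) = 0, and C (A x) = 0. In particular, the subspace {x : P x = 0 and C x = 0} is invariant under A and contained in the kernel of C. -/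
open Matrix

theorem nullspace_invariance {n m : ℕ}
    (A : Matrix (Fin n) (Fin n) ℝ) (B : Matrix (Fin n) (Fin m) ℝ)
    (C : Matrix (Fin m) (Fin n) ℝ)
    (P : Matrix (Fin n) (Fin n) ℝ) (L : Matrix (Fin m) (Fin n) ℝ)
    (W : Matrix (Fin m) (Fin m) ℝ)
    (hPsymm : Pᵀ = P) (hPpsd : P.PosSemidef)
    (h1 : P * A + Aᵀ * P = -(Lᵀ * L))
    (h2 : Bᵀ * P - C * A = -(Wᵀ * L))
    (x : Fin n → ℝ) (hPx : P.mulVec x = 0) (hCx : C.mulVec x = 0) :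
    L.mulVec x = 0 ∧ P.mulVec (A.mulVec x) = 0 ∧ C.mulVec (A.mulVec x) = 0 := by
  have h1x : P *ᵥ (A *ᵥ x) = -(Lᵀ *ᵥ (L *ᵥ x)) := by
    simpa [add_mulVec, neg_mulVec, ← mulVec_mulVec, hPx] using congrArg (· *ᵥ x) h1
  have h2x : C *ᵥ (A *ᵥ x) = Wᵀ *ᵥ (L *ᵥ x) := by
    simpa [sub_mulVec, neg_mulVec, ← mulVec_mulVec, hPx] using congrArg (· *ᵥ x) h2
  have hquad : x ⬝ᵥ (P *ᵥ (A *ᵥ x)) = 0 := by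
    rw [dotProduct_mulVec, ← mulVec_transpose, hPsymm, hPx, zero_dotProduct]
  have hLx : L *ᵥ x = 0 := by
    rw [h1x, dotProduct_neg, neg_eq_zero, dotProduct_mulVec, vecMul_transpose] at hquad
    exact dotProduct_self_eq_zero.mp hquad
  exact ⟨hLx, by simp [h1x, hLx], by simp [h2x, hLx]⟩
end

section
/- Let A ∈ ℝ^{n×n}, B ∈ ℝ^{n×m}, C ∈ ℝ^{m×n}, and suppose P = Pᵀ ∈ ℝ^{n×n} is positive semidefinite and there exist L ∈ ℝ^{m×n}, W ∈ ℝ^{m×m} with P A + Aᵀ P = −Lᵀ L and Bᵀ P − C A = −Wᵀ L. Assume the pair (A, C) is observable, i.e., for every x ∈ ℝⁿ, if C (Aᵏ x) = 0 for all natural numbers k then x = 0. Let Γ = Γᵀ ∈ ℝ^{m×m} be negative definite. Then the real symmetric matrix P − Cᵀ Γ C is positive definite. -/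
open Matrix

/-- If `P * A + Aᵀ * P = -(Lᵀ * L)`, then every vector in the kernel of the symmetric matrix `P`
is in the kernel of `L`. -/
theorem mulVec_eq_zero_of_lyapunov {n m : Type*} [Fintype n] [Fintype m]
    {A P : Matrix n n ℝ} {L : Matrix m n ℝ} (hP : Pᵀ = P)
    (h : P * A + Aᵀ * P = -(Lᵀ * L)) {x : n → ℝ} (hx : P *ᵥ x = 0) : L *ᵥ x = 0 := by
  have hx' : x ᵥ* P = 0 := by rw [← hP, vecMul_transpose, hx]
  have key := congrArg (fun M : Matrix n n ℝ => x ⬝ᵥ M *ᵥ x) h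
  simp only [add_mulVec, neg_mulVec, ← mulVec_mulVec, hx, mulVec_zero, add_zero,
    dotProduct_neg, dotProduct_mulVec, hx', zero_vecMul, zero_dotProduct, vecMul_transpose] at key
  rw [← dotProduct_self_eq_zero, dotProduct_mulVec]
  simpa using key.symm

/-- If `P * A + Aᵀ * P = -(Lᵀ * L)`, then the kernel of the symmetric matrix `P` is invariant
under `A`. -/
theorem mulVec_mulVec_eq_zero_of_lyapunov {n m : Type*} [Fintype n] [Fintype m]
    {A P : Matrix n n ℝ} {L : Matrix m n ℝ} (hP : Pᵀ = P)
    (h : P * A + Aᵀ * P = -(Lᵀ * L)) {x : n → ℝ} (hx : P *ᵥ x = 0) : P *ᵥ (A *ᵥ x) = 0 := by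
  have key := congrArg (· *ᵥ x) h
  simpa [add_mulVec, neg_mulVec, ← mulVec_mulVec, hx, mulVec_eq_zero_of_lyapunov hP h hx]
    using key

theorem P_sub_CtGammaC_posdef {n m : ℕ}
    (A : Matrix (Fin n) (Fin n) ℝ) (B : Matrix (Fin n) (Fin m) ℝ)
    (C : Matrix (Fin m) (Fin n) ℝ)
    (P : Matrix (Fin n) (Fin n) ℝ) (L : Matrix (Fin m) (Fin n) ℝ)
    (W : Matrix (Fin m) (Fin m) ℝ)
    (hPsymm : Pᵀ = P) (hPpsd : P.PosSemidef)
    (h1 : P * A + Aᵀ * P = -(Lᵀ * L))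
    (h2 : Bᵀ * P - C * A = -(Wᵀ * L))
    (hobs : ∀ x : Fin n → ℝ, (∀ k : ℕ, C.mulVec ((A ^ k).mulVec x) = 0) → x = 0)
    (Γ : Matrix (Fin m) (Fin m) ℝ)
    (hΓsymm : Γᵀ = Γ) (hΓnegdef : (-Γ).PosDef) :
    (P - Cᵀ * Γ * C).PosDef := by
  have hC : (Cᵀ * (-Γ) * C).PosSemidef := by
    simpa using hΓnegdef.posSemidef.conjTranspose_mul_mul_same C
  have hsum : P - Cᵀ * Γ * C = P + Cᵀ * (-Γ) * C := by
    simp [sub_eq_add_neg]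
  rw [hsum]
  refine .of_dotProduct_mulVec_pos (hPpsd.add hC).isHermitian fun x hx => ?_
  refine ((hPpsd.add hC).dotProduct_mulVec_nonneg x).lt_of_ne' fun h0 => hx (hobs x ?_)
  have hP0 := hPpsd.dotProduct_mulVec_nonneg x
  have hC0 := hC.dotProduct_mulVec_nonneg x
  rw [add_mulVec, dotProduct_add] at h0
  have hPx : P *ᵥ x = 0 := (hPpsd.dotProduct_mulVec_zero_iff x).mp (by linarith)
  have hCx : C *ᵥ x = 0 := by
    by_contra hne
    have hpos := hΓnegdef.dotProduct_mulVec_pos hne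
    have heq : star x ⬝ᵥ (Cᵀ * (-Γ) * C) *ᵥ x = star (C *ᵥ x) ⬝ᵥ (-Γ) *ᵥ (C *ᵥ x) := by
      simp only [star_trivial, ← mulVec_mulVec, dotProduct_mulVec x Cᵀ, vecMul_transpose]
    linarith
  have hker (k : ℕ) : P *ᵥ (A ^ k *ᵥ x) = 0 := by
    induction k with
    | zero => simpa using hPx
    | succ k ih =>
      rw [pow_succ', ← mulVec_mulVec]
      exact mulVec_mulVec_eq_zero_of_lyapunov hPsymm h1 ih
  rintro (_ | k)
  · simpa using hCx
  · have key := congrArg (· *ᵥ (A ^ k *ᵥ x)) h2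
    rw [pow_succ', ← mulVec_mulVec]
    simpa [sub_mulVec, neg_mulVec, ← mulVec_mulVec, hker k,
      mulVec_eq_zero_of_lyapunov hPsymm h1 (hker k)] using key
end

section
/- Let A₁ ∈ ℝ^{n₁×n₁}, B₁ ∈ ℝ^{n₁×m}, C₁ ∈ ℝ^{m×n₁}, A₂ ∈ ℝ^{n₂×n₂}, B₂ ∈ ℝ^{n₂×m}, C₂ ∈ ℝ^{m×n₂}, and D₂ = D₂ᵀ ∈ ℝ^{m×m}. Suppose P₁ = P₁ᵀ ∈ ℝ^{n₁×n₁}, L₁ ∈ ℝ^{m×n₁}, W₁ ∈ ℝ^{m×m} satisfy P₁A₁ + A₁ᵀP₁ = −L₁ᵀL₁, P₁B₁ − A₁ᵀC₁ᵀ = −L₁ᵀW₁, C₁B₁ + B₁ᵀC₁ᵀ = W₁ᵀW₁, and P₂ = P₂ᵀ ∈ ℝ^{n₂×n₂}, L₂ ∈ ℝ^{m×n₂}, W₂ ∈ ℝ^{m×m} satisfy P₂A₂ + A₂ᵀP₂ = −L₂ᵀL₂, P₂B₂ − A₂ᵀC₂ᵀ = −L₂ᵀW₂, C₂B₂ + B₂ᵀC₂ᵀ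 = W₂ᵀW₂. Define the block matrices T = [[P₁ − C₁ᵀD₂C₁, −C₁ᵀC₂], [−C₂ᵀC₁, P₂]], Ă = [[A₁ + B₁D₂C₁, B₁C₂], [B₂C₁, A₂]], and Z = [[W₁D₂C₁ + L₁, W₁C₂], [W₂C₁, L₂]]. Then T·Ă + Ăᵀ·T = −Zᵀ·Z; in particular T·Ă + Ăᵀ·T is negative semidefinite. -/
open Matrix

theorem closed_loop_lyapunov_identity {n₁ n₂ m : ℕ}
    (A₁ : Matrix (Fin n₁) (Fin n₁) ℝ) (B₁ : Matrix (Fin n₁) (Fin m) ℝ)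
    (C₁ : Matrix (Fin m) (Fin n₁) ℝ)
    (A₂ : Matrix (Fin n₂) (Fin n₂) ℝ) (B₂ : Matrix (Fin n₂) (Fin m) ℝ)
    (C₂ : Matrix (Fin m) (Fin n₂) ℝ) (D₂ : Matrix (Fin m) (Fin m) ℝ)
    (hD₂ : D₂ᵀ = D₂)
    (P₁ : Matrix (Fin n₁) (Fin n₁) ℝ) (L₁ : Matrix (Fin m) (Fin n₁) ℝ)
    (W₁ : Matrix (Fin m) (Fin m) ℝ) (hP₁ : P₁ᵀ = P₁)
    (h11 : P₁ * A₁ + A₁ᵀ * P₁ = -(L₁ᵀ * L₁))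
    (h12 : P₁ * B₁ - A₁ᵀ * C₁ᵀ = -(L₁ᵀ * W₁))
    (h13 : C₁ * B₁ + B₁ᵀ * C₁ᵀ = W₁ᵀ * W₁)
    (P₂ : Matrix (Fin n₂) (Fin n₂) ℝ) (L₂ : Matrix (Fin m) (Fin n₂) ℝ)
    (W₂ : Matrix (Fin m) (Fin m) ℝ) (hP₂ : P₂ᵀ = P₂)
    (h21 : P₂ * A₂ + A₂ᵀ * P₂ = -(L₂ᵀ * L₂))
    (h22 : P₂ * B₂ - A₂ᵀ * C₂ᵀ = -(L₂ᵀ * W₂))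
    (h23 : C₂ * B₂ + B₂ᵀ * C₂ᵀ = W₂ᵀ * W₂) :
    (Matrix.fromBlocks (P₁ - C₁ᵀ * D₂ * C₁) (-(C₁ᵀ * C₂)) (-(C₂ᵀ * C₁)) P₂ *
        Matrix.fromBlocks (A₁ + B₁ * D₂ * C₁) (B₁ * C₂) (B₂ * C₁) A₂
      + (Matrix.fromBlocks (A₁ + B₁ * D₂ * C₁) (B₁ * C₂) (B₂ * C₁) A₂)ᵀ *
        Matrix.fromBlocks (P₁ - C₁ᵀ * D₂ * C₁) (-(C₁ᵀ * C₂)) (-(C₂ᵀ * C₁)) P₂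
      = -((Matrix.fromBlocks (W₁ * D₂ * C₁ + L₁) (W₁ * C₂) (W₂ * C₁) L₂)ᵀ *
          Matrix.fromBlocks (W₁ * D₂ * C₁ + L₁) (W₁ * C₂) (W₂ * C₁) L₂)) ∧
    (-(Matrix.fromBlocks (P₁ - C₁ᵀ * D₂ * C₁) (-(C₁ᵀ * C₂)) (-(C₂ᵀ * C₁)) P₂ *
        Matrix.fromBlocks (A₁ + B₁ * D₂ * C₁) (B₁ * C₂) (B₂ * C₁) A₂
      + (Matrix.fromBlocks (A₁ + B₁ * D₂ * C₁) (B₁ * C₂) (B₂ * C₁) A₂)ᵀ *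
        Matrix.fromBlocks (P₁ - C₁ᵀ * D₂ * C₁) (-(C₁ᵀ * C₂)) (-(C₂ᵀ * C₁)) P₂)).PosSemidef := by
  have h12t : B₁ᵀ * P₁ - C₁ * A₁ = -(W₁ᵀ * L₁) := by
    simpa [transpose_mul, hP₁] using congrArg transpose h12
  have h22t : B₂ᵀ * P₂ - C₂ * A₂ = -(W₂ᵀ * L₂) := by
    simpa [transpose_mul, hP₂] using congrArg transpose h22
  refine and_iff_left_of_imp (fun h => ?_) |>.mpr ?_
  · rw [h, neg_neg]
    simpa only [conjTranspose_eq_transpose_of_trivial] using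
      posSemidef_conjTranspose_mul_self
        (fromBlocks (W₁ * D₂ * C₁ + L₁) (W₁ * C₂) (W₂ * C₁) L₂)
  simp only [fromBlocks_transpose, fromBlocks_multiply, fromBlocks_add, fromBlocks_neg,
    transpose_add, transpose_mul, hD₂]
  congr 1
  · have e1 := congrArg (· * (D₂ * C₁)) h12
    have e2 := congrArg (C₁ᵀ * D₂ * ·) h12t
    have e3 := congrArg (C₁ᵀ * D₂ * · * (D₂ * C₁)) h13
    have e4 := congrArg (C₁ᵀ * · * C₁) h23
    simp only [Matrix.mul_add, Matrix.add_mul, Matrix.mul_sub, Matrix.sub_mul, Matrix.mul_neg,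
      Matrix.neg_mul, Matrix.mul_assoc] at e1 e2 e3 e4 ⊢
    linear_combination (norm := abel) h11 + e1 + e2 - e3 - e4
  · have e1 := congrArg (· * C₂) h12
    have e2 := congrArg (C₁ᵀ * ·) h22t
    have e3 := congrArg (C₁ᵀ * D₂ * · * C₂) h13
    simp only [Matrix.mul_add, Matrix.add_mul, Matrix.mul_sub, Matrix.sub_mul, Matrix.mul_neg,
      Matrix.neg_mul, Matrix.mul_assoc] at e1 e2 e3 ⊢
    linear_combination (norm := abel) e1 + e2 - e3
  · have e1 := congrArg (C₂ᵀ * ·) h12t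
    have e2 := congrArg (· * C₁) h22
    have e3 := congrArg (C₂ᵀ * · * (D₂ * C₁)) h13
    simp only [Matrix.mul_add, Matrix.add_mul, Matrix.mul_sub, Matrix.sub_mul, Matrix.mul_neg,
      Matrix.neg_mul, Matrix.mul_assoc] at e1 e2 e3 ⊢
    linear_combination (norm := abel) e1 + e2 - e3
  · have e1 := congrArg (C₂ᵀ * · * C₂) h13
    simp only [Matrix.mul_add, Matrix.add_mul, Matrix.mul_neg, Matrix.neg_mul,
      Matrix.mul_assoc] at e1 ⊢
    linear_combination (norm := abel) h21 - e1
end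

section
/- Let M ∈ ℝ^{n×n} and let T = Tᵀ ∈ ℝ^{n×n} be positive definite with T·M + Mᵀ·T negative semidefinite. Then every eigenvalue λ ∈ ℂ of the complexification of M satisfies Re(λ) ≤ 0. -/
open Matrix

namespace Matrix

variable {ι : Type*} [Fintype ι]

theorem exists_mulVec_eq_smul_of_mem_spectrum [DecidableEq ι] {K : Type*} [Field K]
    {A : Matrix ι ι K} {μ : K} (h : μ ∈ spectrum K A) : ∃ v, v ≠ 0 ∧ A *ᵥ v = μ • v := by
  rw [← Matrix.spectrum_toLin', ← Module.End.hasEigenvalue_iff_mem_spectrum] at h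
  obtain ⟨v, hv⟩ := h.exists_hasEigenvector
  exact ⟨v, hv.2, by simpa using hv.apply_eq_smul⟩

theorem IsSymm.dotProduct_mulVec_comm {R : Type*} [CommRing R] {T : Matrix ι ι R} (hT : T.IsSymm)
    (x y : ι → R) : x ⬝ᵥ T *ᵥ y = y ⬝ᵥ T *ᵥ x := by
  rw [dotProduct_mulVec, ← mulVec_transpose, hT.eq, dotProduct_comm]

theorem IsSymm.dotProduct_lyapunov_mulVec {R : Type*} [CommRing R] {T : Matrix ι ι R}
    (hT : T.IsSymm) (M : Matrix ι ι R) (x : ι → R) :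
    x ⬝ᵥ (T * M + Mᵀ * T) *ᵥ x = 2 * (x ⬝ᵥ T *ᵥ (M *ᵥ x)) := by
  have h : x ⬝ᵥ Mᵀ *ᵥ (T *ᵥ x) = x ⬝ᵥ T *ᵥ (M *ᵥ x) := by
    rw [dotProduct_mulVec, vecMul_transpose, hT.dotProduct_mulVec_comm]
  rw [add_mulVec, dotProduct_add, ← mulVec_mulVec, ← mulVec_mulVec, h, two_mul]

theorem re_map_ofReal_mulVec (M : Matrix ι ι ℝ) (v : ι → ℂ) (i : ι) :
    ((M.map Complex.ofReal *ᵥ v) i).re = (M *ᵥ fun j => (v j).re) i := by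
  simp [mulVec, dotProduct]

theorem im_map_ofReal_mulVec (M : Matrix ι ι ℝ) (v : ι → ℂ) (i : ι) :
    ((M.map Complex.ofReal *ᵥ v) i).im = (M *ᵥ fun j => (v j).im) i := by
  simp [mulVec, dotProduct]

end Matrix

theorem lyapunov_eigenvalues_closed_left_half_plane {n : ℕ}
    (M T : Matrix (Fin n) (Fin n) ℝ)
    (hTsymm : Tᵀ = T) (hTpd : T.PosDef)
    (hLyap : (-(T * M + Mᵀ * T)).PosSemidef) :
    ∀ lam : ℂ, lam ∈ spectrum ℂ (M.map Complex.ofReal) → lam.re ≤ 0 := by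
  intro lam hlam
  obtain ⟨v, hv, hMv⟩ := exists_mulVec_eq_smul_of_mem_spectrum hlam
  have hT : T.IsSymm := hTsymm
  set x : Fin n → ℝ := fun j => (v j).re with hx
  set y : Fin n → ℝ := fun j => (v j).im with hy
  have hMx : M *ᵥ x = lam.re • x - lam.im • y := by
    ext i
    rw [← re_map_ofReal_mulVec, hMv]
    simp [hx, hy]
  have hMy : M *ᵥ y = lam.re • y + lam.im • x := by
    ext i
    rw [← im_map_ofReal_mulVec, hMv]
    simp [hx, hy]
  have hneg (z : Fin n → ℝ) : z ⬝ᵥ T *ᵥ (M *ᵥ z) ≤ 0 := by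
    have h := hLyap.dotProduct_mulVec_nonneg z
    rw [star_trivial, neg_mulVec, dotProduct_neg, hT.dotProduct_lyapunov_mulVec] at h
    linarith
  have hnonneg (z : Fin n → ℝ) : 0 ≤ z ⬝ᵥ T *ᵥ z := by
    simpa using hTpd.posSemidef.dotProduct_mulVec_nonneg z
  have hpos (z : Fin n → ℝ) (hz : z ≠ 0) : 0 < z ⬝ᵥ T *ᵥ z := by
    simpa using hTpd.dotProduct_mulVec_pos hz
  have hsum : 0 < x ⬝ᵥ T *ᵥ x + y ⬝ᵥ T *ᵥ y := by
    by_cases hx0 : x = 0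
    · have hy0 : y ≠ 0 := fun hy0 =>
        hv (funext fun i => Complex.ext (congrFun hx0 i) (congrFun hy0 i))
      exact add_pos_of_nonneg_of_pos (hnonneg x) (hpos y hy0)
    · exact add_pos_of_pos_of_nonneg (hpos x hx0) (hnonneg y)
  have h₁ := hneg x
  have h₂ := hneg y
  rw [hMx, mulVec_sub, mulVec_smul, mulVec_smul, dotProduct_sub, dotProduct_smul,
    dotProduct_smul, smul_eq_mul, smul_eq_mul] at h₁
  rw [hMy, mulVec_add, mulVec_smul, mulVec_smul, dotProduct_add, dotProduct_smul,
    dotProduct_smul, smul_eq_mul, smul_eq_mul, hT.dotProduct_mulVec_comm y x] at h₂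
  refine nonpos_of_mul_nonpos_left ?_ hsum
  linarith
end

section
/- Let A₁ ∈ ℝ^{n₁×n₁}, B₁ ∈ ℝ^{n₁×m}, C₁ ∈ ℝ^{m×n₁}, A₂ ∈ ℝ^{n₂×n₂}, B₂ ∈ ℝ^{n₂×m}, C₂ ∈ ℝ^{m×n₂}, D₂ ∈ ℝ^{m×m}, and let λ ∈ ℂ be such that the complex matrices λI − A₁ and λI − A₂ are invertible (real matrices identified with their complex images entrywise). If λ is an eigenvalue of the complexification of Ă = [[A₁ + B₁D₂C₁, B₁C₂], [B₂C₁, A₂]], then det(I − G₁(λ)·G₂(λ)) = 0, where G₁(λ) = C₁(λI − A₁)⁻¹B₁ and G₂(λ) = C₂(λI − A₂)⁻¹B₂ + D₂. -/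
open Matrix

/-- The characteristic determinant of a positive-feedback interconnection factors through the
determinants of the two resolvents and of the return difference `1 - G₁ * G₂`. -/
theorem det_fromBlocks_feedback {R p q r : Type*} [CommRing R]
    [Fintype p] [DecidableEq p] [Fintype q] [DecidableEq q] [Fintype r] [DecidableEq r]
    (M₁ : Matrix p p R) (B₁ : Matrix p r R) (C₁ : Matrix r p R)
    (M₂ : Matrix q q R) (B₂ : Matrix q r R) (C₂ : Matrix r q R) (D₂ : Matrix r r R)
    (h₁ : IsUnit M₁) (h₂ : IsUnit M₂) :
    (fromBlocks (M₁ - B₁ * D₂ * C₁) (-(B₁ * C₂)) (-(B₂ * C₁)) M₂).det =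
      M₂.det * (M₁.det * (1 - (C₁ * M₁⁻¹ * B₁) * (C₂ * M₂⁻¹ * B₂ + D₂)).det) := by
  have hM₁ : M₁ * M₁⁻¹ = 1 := mul_nonsing_inv _ ((isUnit_iff_isUnit_det _).1 h₁)
  let _ := h₂.invertible
  rw [det_fromBlocks₂₂, invOf_eq_nonsing_inv]
  congr 1
  have hSchur : M₁ - B₁ * D₂ * C₁ - -(B₁ * C₂) * M₂⁻¹ * -(B₂ * C₁) =
      M₁ * (1 - M₁⁻¹ * B₁ * (C₂ * M₂⁻¹ * B₂ + D₂) * C₁) := by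
    simp only [Matrix.mul_sub, Matrix.mul_one, ← Matrix.mul_assoc, hM₁, Matrix.one_mul,
      Matrix.mul_add, Matrix.add_mul, Matrix.neg_mul, Matrix.mul_neg, neg_neg]
    abel
  rw [hSchur, det_mul, det_one_sub_mul_comm]
  simp only [Matrix.mul_assoc]

theorem eigenvalue_implies_det_loop_zero {n₁ n₂ m : ℕ}
    (A₁ : Matrix (Fin n₁) (Fin n₁) ℝ) (B₁ : Matrix (Fin n₁) (Fin m) ℝ)
    (C₁ : Matrix (Fin m) (Fin n₁) ℝ)
    (A₂ : Matrix (Fin n₂) (Fin n₂) ℝ) (B₂ : Matrix (Fin n₂) (Fin m) ℝ)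
    (C₂ : Matrix (Fin m) (Fin n₂) ℝ) (D₂ : Matrix (Fin m) (Fin m) ℝ)
    (lam : ℂ)
    (h₁ : IsUnit (lam • (1 : Matrix (Fin n₁) (Fin n₁) ℂ) - A₁.map Complex.ofReal))
    (h₂ : IsUnit (lam • (1 : Matrix (Fin n₂) (Fin n₂) ℂ) - A₂.map Complex.ofReal))
    (hspec : lam ∈ spectrum ℂ
      ((Matrix.fromBlocks (A₁ + B₁ * D₂ * C₁) (B₁ * C₂) (B₂ * C₁) A₂).map Complex.ofReal)) :
    (1 - (C₁.map Complex.ofReal *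
        (lam • (1 : Matrix (Fin n₁) (Fin n₁) ℂ) - A₁.map Complex.ofReal)⁻¹ *
        B₁.map Complex.ofReal) *
      (C₂.map Complex.ofReal *
        (lam • (1 : Matrix (Fin n₂) (Fin n₂) ℂ) - A₂.map Complex.ofReal)⁻¹ *
        B₂.map Complex.ofReal + D₂.map Complex.ofReal)).det = 0 := by
  have hblock : algebraMap ℂ (Matrix (Fin n₁ ⊕ Fin n₂) (Fin n₁ ⊕ Fin n₂) ℂ) lam -
      (fromBlocks (A₁ + B₁ * D₂ * C₁) (B₁ * C₂) (B₂ * C₁) A₂).map Complex.ofReal =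
      fromBlocks
        (lam • 1 - A₁.map Complex.ofReal -
          B₁.map Complex.ofReal * D₂.map Complex.ofReal * C₁.map Complex.ofReal)
        (-(B₁.map Complex.ofReal * C₂.map Complex.ofReal))
        (-(B₂.map Complex.ofReal * C₁.map Complex.ofReal))
        (lam • 1 - A₂.map Complex.ofReal) := by
    have hmul {k l s : ℕ} (X : Matrix (Fin k) (Fin l) ℝ) (Y : Matrix (Fin l) (Fin s) ℝ) :
        (X * Y).map Complex.ofReal = X.map Complex.ofReal * Y.map Complex.ofReal :=
      Matrix.map_mul (f := Complex.ofRealHom)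
    rw [Algebra.algebraMap_eq_smul_one, ← fromBlocks_one, fromBlocks_smul, fromBlocks_map,
      Matrix.map_add _ Complex.ofReal_add, hmul, hmul, hmul, hmul, sub_eq_add_neg,
      fromBlocks_neg, fromBlocks_add]
    simp only [smul_zero, zero_add, neg_add, sub_eq_add_neg, add_assoc]
  rw [spectrum.mem_iff, hblock, isUnit_iff_isUnit_det, det_fromBlocks_feedback _ _ _ _ _ _ _ h₁ h₂,
    isUnit_iff_ne_zero, not_not] at hspec
  rw [isUnit_iff_isUnit_det, isUnit_iff_ne_zero] at h₁ h₂
  exact ((mul_eq_zero.1 hspec).resolve_left h₂ |> mul_eq_zero.1).resolve_left h₁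
end
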